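/- For every n ≥ 0, the normalized Feynman-Kac path measure admits the backward Markov chain representation ℚ_n(d(x_0,…,x_n)) = η_n(dx_n) ∏_{q=1}^{n} M_{q,η_{q-1}}(x_q, dx_{q-1}), as an equality of probability measures on E_0 × ⋯ × E_n. (Second assertion of Lemma 4.1.) -/

import Mathlib

open MeasureTheory ProbabilityTheory ENNReal

noncomputable section

variable {E : ℕ → Type*} [∀ n, MeasurableSpace (E n)]

/-- Normalization `μ / μ(1)` of a measure. -/
def nz {α : Type*} [MeasurableSpace α] (μ : Measure α) : Measure α := (μ Set.univ)⁻¹ • μ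

variable (M : ∀ n, Kernel (E n) (E (n+1))) (G : ∀ n, E n → ℝ) (H : ∀ n, E n → E (n+1) → ℝ)

/-- The Feynman-Kac kernel `Q_{q+1}(x,dy) = G_q(x) M_{q+1}(x,dy)`. -/
def Qk (q : ℕ) (x : E q) : Measure (E (q+1)) := ENNReal.ofReal (G q x) • (M q x : Measure (E (q+1)))

/-- The backward kernel `M_{q+1,η}(y,dx) = G_q(x) H_{q+1}(x,y) η(dx) / η(G_q H_{q+1}(·,y))`. -/
def Mback (q : ℕ) (η : Measure (E q)) (y : E (q+1)) : Measure (E q) :=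
  (∫⁻ x, ENNReal.ofReal (G q x * H q x y) ∂η)⁻¹ •
    η.withDensity fun x => ENNReal.ofReal (G q x * H q x y)

/-- The unnormalized Feynman-Kac marginal `γ_n = η₀ Q_{0,n}`. -/
def gamma (η0 : Measure (E 0)) : ∀ n, Measure (E n)
  | 0 => η0
  | n + 1 => (gamma η0 n).bind (Qk M G n)

/-- The Boltzmann-Gibbs transform `Ψ_{G_q}(η)(dx) = G_q(x) η(dx) / η(G_q)`. -/
def PsiG (q : ℕ) (η : Measure (E q)) : Measure (E q) :=
  (∫⁻ x, ENNReal.ofReal (G q x) ∂η)⁻¹ • η.withDensity fun x => ENNReal.ofReal (G q x)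

/-- `Φ_{q+1}(η) = Ψ_{G_q}(η) M_{q+1}`. -/
def Phi (q : ℕ) (η : Measure (E q)) : Measure (E (q+1)) :=
  (PsiG G q η).bind fun x => (M q x : Measure (E (q+1)))

/-- `η Q_{p,q}` as a measure on `E q` (junk `0` for `q < p`). -/
def QQabs (p : ℕ) (η : Measure (E p)) : ∀ q, Measure (E q)
  | 0 => if h : p = 0 then cast (congrArg (fun m => Measure (E m)) h) η else 0
  | q + 1 =>
      if h : p = q + 1 then cast (congrArg (fun m => Measure (E m)) h) η
      else (QQabs p η q).bind (Qk M G q)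

/-- Forward segment integral: `x_p ↦ ∫ ∏_{p ≤ q < p+k} Q_{q+1}(x_q, dx_{q+1}) F(x_p,…,x_{p+k})`. -/
def fwdSeg (p : ℕ) : (k : ℕ) → E p → ((∀ i : Fin (k+1), E (p + ↑i)) → ℝ) → ℝ
  | 0, x, F => F (Fin.cons x fun j => j.elim0)
  | k + 1, x, F =>
      fwdSeg p k x fun xs => ∫ y, F (Fin.snoc xs y) ∂ (Qk M G (p + k) (xs (Fin.last k)))

/-- Backward segment integral from `x_{p+k}`:
`x_{p+k} ↦ ∫ ∏_{p ≤ q < p+k} M_{q+1,θ_q}(x_{q+1}, dx_q) F(x_p,…,x_{p+k})`. -/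
def bwdSeg (θ : ∀ q, Measure (E q)) (p : ℕ) :
    (k : ℕ) → E (p + k) → ((∀ i : Fin (k+1), E (p + ↑i)) → ℝ) → ℝ
  | 0, x, F => F (Fin.cons x fun j => j.elim0)
  | k + 1, x, F =>
      ∫ y, bwdSeg θ p k y (fun xs => F (Fin.snoc xs x)) ∂ (Mback G H (p + k) (θ (p + k)) x)

/-- Backward integral from level `p` down to level `0`:
`x_p ↦ ∫ ∏_{q=1}^{p} M_{q,θ_{q-1}}(x_q, dx_{q-1}) F(x_0,…,x_p)`. -/
def bwd0 (θ : ∀ q, Measure (E q)) : (p : ℕ) → E p → ((∀ i : Fin (p+1), E ↑i) → ℝ) → ℝ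
  | 0, x, F => F (Fin.cons x fun j => j.elim0)
  | p + 1, x, F => ∫ y, bwd0 θ p y (fun xs => F (Fin.snoc xs x)) ∂ (Mback G H p (θ p) x)

/-- Integrate out the coordinates `p+1,…,n` of `F` forward through the `Q` chain. -/
def fwdAbs (p : ℕ) : (n : ℕ) → ((∀ i : Fin (n+1), E ↑i) → ℝ) → (∀ i : Fin (p+1), E ↑i) → ℝ
  | 0, F => fun xs => F fun i => xs (Fin.castLE (by omega) i)
  | n + 1, F =>
      if h : n + 1 ≤ p then fun xs => F fun i => xs (Fin.castLE (by omega) i)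
      else fwdAbs p n fun xs => ∫ y, F (Fin.snoc xs y) ∂ (Qk M G n (xs (Fin.last n)))

/-- The operator `D_{p,n}` associated to the family of backward measures `θ`. -/
def Dop (θ : ∀ q, Measure (E q)) (p n : ℕ) (F : (∀ i : Fin (n+1), E ↑i) → ℝ) (x : E p) : ℝ :=
  bwd0 G H θ p x (fwdAbs M G p n F)

/-- `Γ_n(F)`, the unnormalized Feynman-Kac path integral. -/
def GammaInt (η0 : Measure (E 0)) : (n : ℕ) → ((∀ i : Fin (n+1), E ↑i) → ℝ) → ℝ
  | 0, F => ∫ x, F (Fin.cons x fun j => j.elim0) ∂ η0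
  | n + 1, F => GammaInt η0 n fun xs => ∫ y, F (Fin.snoc xs y) ∂ (Qk M G n (xs (Fin.last n)))

/-- `Q_{p,n}(f)` acting on functions (junk `0` if `n < p`). -/
def Qfun (p : ℕ) : (n : ℕ) → (E n → ℝ) → E p → ℝ
  | 0, f => if h : p = 0 then fun x => f (cast (congrArg E h) x) else 0
  | n + 1, f =>
      if h : p = n + 1 then fun x => f (cast (congrArg E h) x)
      else Qfun p n fun x => ∫ y, f y ∂ (Qk M G n x)

/-- The composition `M_{n,θ_{n-1}} M_{n-1,θ_{n-2}} ⋯ M_{p+1,θ_p}` acting on functions on `E p`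
(identity when `n = p`, junk `0` if `n < p`). -/
def Mchain (θ : ∀ q, Measure (E q)) (p : ℕ) : (n : ℕ) → (E p → ℝ) → E n → ℝ
  | 0, f => if h : p = 0 then fun x => f (cast (congrArg E h.symm) x) else 0
  | n + 1, f =>
      if h : p = n + 1 then fun x => f (cast (congrArg E h.symm) x)
      else fun x => ∫ y, Mchain θ p n f y ∂ (Mback G H n (θ n) x)

/-- The forward recursion `F_0 = f_0`, `F_{p+1} = f_{p+1} + M_{p+1,θ_p}(F_p)`. -/
def Frec (θ : ∀ q, Measure (E q)) (f : ∀ q, E q → ℝ) : ∀ p, E p → ℝ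
  | 0 => f 0
  | p + 1 => fun x => f (p+1) x + ∫ y, Frec θ f p y ∂ (Mback G H p (θ p) x)

/-- Glue a path `(x_0,…,x_p)` with a segment `(x_p,…,x_{p+k})`. -/
def glue (p k : ℕ) (xs : ∀ i : Fin (p+1), E ↑i) (ys : ∀ i : Fin (k+1), E (p + ↑i)) :
    ∀ i : Fin (p+k+1), E ↑i := fun i =>
  if h : (i : ℕ) ≤ p then xs ⟨i, by omega⟩
  else cast (congrArg E (show p + ((i : ℕ) - p) = (i : ℕ) by omega))
    (ys ⟨(i : ℕ) - p, by have := i.isLt; omega⟩)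

/-- The oscillation `osc(f) = sup_{x,y} |f x - f y|`. -/
def osc {α : Type*} (f : α → ℝ) : ℝ := sSup {d | ∃ x y, d = |f x - f y|}

/-- The Dobrushin contraction coefficient of an operator mapping functions on `α`
to functions on `β`. -/
def betaOp {α β : Type*} [MeasurableSpace α] (T : (α → ℝ) → β → ℝ) : ℝ :=
  sSup {r | ∃ φ : α → ℝ, Measurable φ ∧ (∀ x y, |φ x - φ y| ≤ 1) ∧ r = osc (T φ)}

/-- Empirical measure of an `N`-tuple. -/
def emp {α : Type*} [MeasurableSpace α] {N : ℕ} (x : Fin N → α) : Measure α :=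
  (N : ℝ≥0∞)⁻¹ • ∑ i, Measure.dirac (x i)


section PathMeasures

lemma measurable_finCons_elim0 :
    Measurable (fun x : E 0 => (Fin.cons x fun j => j.elim0 : ∀ i : Fin (0+1), E ↑i)) := by
  refine measurable_pi_iff.2 fun i => ?_
  induction i using Fin.cases with
  | zero => exact measurable_id
  | succ j => exact j.elim0

lemma measurable_finSnoc (n : ℕ) :
    Measurable (fun p : (∀ i : Fin (n+1), E ↑i) × E (n+1) =>
      (Fin.snoc p.1 p.2 : ∀ i : Fin (n+2), E ↑i)) := by
  refine measurable_pi_iff.2 fun i => ?_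
  induction i using Fin.lastCases with
  | last =>
    simp only [Fin.snoc_last]
    exact measurable_snd
  | cast j =>
    simp only [Fin.snoc_castSucc]
    exact (measurable_pi_apply (X := fun i : Fin (n+1) => E ↑i) j).comp measurable_fst

lemma measurable_finSnoc_left (n : ℕ) (x : E (n+1)) :
    Measurable (fun xs : (∀ i : Fin (n+1), E ↑i) => (Fin.snoc xs x : ∀ i : Fin (n+2), E ↑i)) :=
  (measurable_finSnoc n).comp measurable_prodMk_right

lemma measurable_apply_last (n : ℕ) :
    Measurable (fun xs : (∀ i : Fin (n+1), E ↑i) => (xs (Fin.last n) : E n)) :=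
  measurable_pi_apply (X := fun i : Fin (n+1) => E ↑i) (Fin.last n)

/-- The law of the path `(x_0,…,x_n)` obtained by moving backward from `x_n` with the kernels `K`. -/
def backwardPath (K : ∀ n, Kernel (E (n+1)) (E n)) :
    ∀ n, Kernel (E n) (∀ i : Fin (n+1), E ↑i)
  | 0 => Kernel.deterministic _ measurable_finCons_elim0
  | n + 1 => ((backwardPath K n ∘ₖ K n) ×ₖ Kernel.id).map
      fun p => (Fin.snoc p.1 p.2 : ∀ i : Fin (n+2), E ↑i)

/-- The measure on paths obtained by moving forward from `η0` with the kernels `Q`. -/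
def forwardPath (Q : ∀ n, Kernel (E n) (E (n+1))) (η0 : Measure (E 0)) :
    ∀ n, Measure (∀ i : Fin (n+1), E ↑i)
  | 0 => η0.map fun x => (Fin.cons x fun j => j.elim0 : ∀ i : Fin (0+1), E ↑i)
  | n + 1 => (forwardPath Q η0 n ⊗ₘ (Q n).comap _ (measurable_apply_last n)).map
      fun p => (Fin.snoc p.1 p.2 : ∀ i : Fin (n+2), E ↑i)

instance isMarkovKernel_backwardPath (K : ∀ n, Kernel (E (n+1)) (E n))
    [∀ n, IsMarkovKernel (K n)] (n : ℕ) : IsMarkovKernel (backwardPath K n) := by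
  induction n with
  | zero => exact Kernel.isMarkovKernel_deterministic _
  | succ n ih => exact Kernel.IsMarkovKernel.map _ (measurable_finSnoc n)

instance isFiniteMeasure_forwardPath (Q : ∀ n, Kernel (E n) (E (n+1))) [∀ n, IsFiniteKernel (Q n)]
    (η0 : Measure (E 0)) [IsFiniteMeasure η0] (n : ℕ) : IsFiniteMeasure (forwardPath Q η0 n) := by
  induction n with
  | zero => exact Measure.isFiniteMeasure_map _ _
  | succ n ih => exact Measure.isFiniteMeasure_map _ _

lemma integrable_of_measurable_of_bounded {α : Type*} [MeasurableSpace α] {μ : Measure α}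
    [IsFiniteMeasure μ] {f : α → ℝ} (hf : Measurable f) (hb : ∃ C, ∀ x, |f x| ≤ C) :
    Integrable f μ :=
  let ⟨C, hC⟩ := hb
  .of_bound hf.aestronglyMeasurable C (ae_of_all _ hC)

lemma lintegral_backwardPath_succ (K : ∀ n, Kernel (E (n+1)) (E n)) [∀ n, IsMarkovKernel (K n)]
    (n : ℕ) (x : E (n+1)) {f : (∀ i : Fin (n+2), E ↑i) → ℝ≥0∞} (hf : Measurable f) :
    ∫⁻ xs, f xs ∂(backwardPath K (n+1) x)
      = ∫⁻ y, ∫⁻ xs, f (Fin.snoc xs x) ∂(backwardPath K n y) ∂(K n x) := by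
  have hs : Measurable fun p : (∀ i : Fin (n+1), E ↑i) × E (n+1) => f (Fin.snoc p.1 p.2) :=
    hf.comp (measurable_finSnoc n)
  rw [backwardPath, Kernel.lintegral_map _ (measurable_finSnoc n) _ hf,
    Kernel.lintegral_prod _ _ _ hs, Kernel.lintegral_comp _ _ _ hs.lintegral_prod_right']
  refine lintegral_congr fun y => lintegral_congr fun xs => ?_
  exact Kernel.lintegral_id' (hs.comp measurable_prodMk_left) x

/-- A backward path started at `x` ends at `x`. -/
lemma lintegral_backwardPath_last (K : ∀ n, Kernel (E (n+1)) (E n)) [∀ n, IsMarkovKernel (K n)]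
    (n : ℕ) (x : E n) {f : (∀ i : Fin (n+1), E ↑i) × E n → ℝ≥0∞} (hf : Measurable f) :
    ∫⁻ xs, f (xs, xs (Fin.last n)) ∂(backwardPath K n x)
      = ∫⁻ xs, f (xs, x) ∂(backwardPath K n x) := by
  have h1 : Measurable fun xs : (∀ i : Fin (n+1), E ↑i) => f (xs, xs (Fin.last n)) :=
    hf.comp (measurable_id.prodMk (measurable_apply_last n))
  have h2 : Measurable fun xs : (∀ i : Fin (n+1), E ↑i) => f (xs, x) :=
    hf.comp measurable_prodMk_right
  cases n with
  | zero =>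
    rw [backwardPath, Kernel.lintegral_deterministic' _ h1, Kernel.lintegral_deterministic' _ h2]
    rfl
  | succ n =>
    rw [lintegral_backwardPath_succ K n x h1, lintegral_backwardPath_succ K n x h2]
    simp only [Fin.snoc_last]

lemma bwd0_eq_integral_backwardPath (K : ∀ n, Kernel (E (n+1)) (E n)) [∀ n, IsMarkovKernel (K n)]
    (θ : ∀ q, Measure (E q)) (hK : ∀ q y, K q y = Mback G H q (θ q) y) (n : ℕ) (x : E n)
    (F : (∀ i : Fin (n+1), E ↑i) → ℝ) (hFm : Measurable F) (hFb : ∃ C, ∀ x, |F x| ≤ C) :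
    bwd0 G H θ n x F = ∫ xs, F xs ∂(backwardPath K n x) := by
  induction n with
  | zero =>
    rw [bwd0, backwardPath, Kernel.integral_deterministic' _ hFm.stronglyMeasurable]
  | succ n ih =>
    have hF' : Measurable fun xs : (∀ i : Fin (n+1), E ↑i) => F (Fin.snoc xs x) :=
      hFm.comp (measurable_finSnoc_left n x)
    have hb' : ∃ C, ∀ xs : (∀ i : Fin (n+1), E ↑i), |F (Fin.snoc xs x)| ≤ C :=
      hFb.imp fun C hC xs => hC _
    have hpath : backwardPath K (n+1) x = ((backwardPath K n ∘ₖ K n) x).map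
        fun xs => (Fin.snoc xs x : ∀ i : Fin (n+2), E ↑i) := by
      refine Measure.ext_of_lintegral _ fun f hf => ?_
      have hfs : Measurable fun xs : (∀ i : Fin (n+1), E ↑i) => f (Fin.snoc xs x) :=
        hf.comp (measurable_finSnoc_left n x)
      rw [lintegral_backwardPath_succ K n x hf, ← Kernel.lintegral_comp _ _ _ hfs]
      exact (lintegral_map hf (measurable_finSnoc_left n x)).symm
    have hmap : ∫ xs, F xs ∂(backwardPath K (n+1) x)
        = ∫ xs, F (Fin.snoc xs x) ∂((backwardPath K n ∘ₖ K n) x) := by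
      rw [hpath]
      exact integral_map (measurable_finSnoc_left n x).aemeasurable hFm.aestronglyMeasurable
    rw [hmap, Kernel.integral_comp (integrable_of_measurable_of_bounded hF' hb'), bwd0, ← hK]
    exact integral_congr_ae (ae_of_all _ fun y => ih y _ hF' hb')

lemma GammaInt_eq_integral_forwardPath (Q : ∀ n, Kernel (E n) (E (n+1)))
    [∀ n, IsFiniteKernel (Q n)] (hQ : ∀ q x, Q q x = Qk M G q x)
    (η0 : Measure (E 0)) [IsFiniteMeasure η0] (n : ℕ)
    (F : (∀ i : Fin (n+1), E ↑i) → ℝ) (hFm : Measurable F) (hFb : ∃ C, ∀ x, |F x| ≤ C) :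
    GammaInt M G η0 n F = ∫ xs, F xs ∂(forwardPath Q η0 n) := by
  induction n with
  | zero =>
    exact (integral_map measurable_finCons_elim0.aemeasurable hFm.aestronglyMeasurable).symm
  | succ n ih =>
    have hF' : Measurable fun p : (∀ i : Fin (n+1), E ↑i) × E (n+1) => F (Fin.snoc p.1 p.2) :=
      hFm.comp (measurable_finSnoc n)
    have hb' : ∃ C, ∀ p : (∀ i : Fin (n+1), E ↑i) × E (n+1), |F (Fin.snoc p.1 p.2)| ≤ C :=
      hFb.imp fun C hC xs => hC _
    rw [forwardPath, integral_map (measurable_finSnoc n).aemeasurable hFm.aestronglyMeasurable,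
      Measure.integral_compProd (integrable_of_measurable_of_bounded hF' hb'), GammaInt]
    simp only [← hQ]
    refine ih (fun xs => ∫ y, F (Fin.snoc xs y) ∂(Q n (xs (Fin.last n)))) ?_ ?_
    · exact (hF'.stronglyMeasurable.integral_kernel_prod_right'
        (κ := (Q n).comap _ (measurable_apply_last n))).measurable
    · obtain ⟨C, hC⟩ := hFb
      refine ⟨|C| * (Q n).bound.toReal, fun xs => ?_⟩
      refine (norm_integral_le_of_norm_le_const
        (f := fun y => F (Fin.snoc xs y)) (ae_of_all _ fun y => (hC _).trans (le_abs_self C))).trans ?_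
      gcongr
      exact toReal_mono (Q n).bound_ne_top (Kernel.measure_le_bound _ _ _)

/-- If the backward kernels `K` reverse the forward kernels `Q` along the flow `μ`, then the forward
path measure is obtained by moving backward from the terminal law. -/
lemma forwardPath_eq_backwardPath_comp (Q : ∀ n, Kernel (E n) (E (n+1)))
    [∀ n, IsFiniteKernel (Q n)] (K : ∀ n, Kernel (E (n+1)) (E n)) [∀ n, IsMarkovKernel (K n)]
    (μ : ∀ n, Measure (E n)) [∀ n, IsFiniteMeasure (μ n)]
    (hrev : ∀ n (g : E n × E (n+1) → ℝ≥0∞), Measurable g →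
      ∫⁻ x, ∫⁻ y, g (x, y) ∂(Q n x) ∂(μ n) = ∫⁻ y, ∫⁻ x, g (x, y) ∂(K n y) ∂(μ (n+1)))
    (n : ℕ) : forwardPath Q (μ 0) n = (μ n).bind (backwardPath K n) := by
  induction n with
  | zero =>
    rw [forwardPath, backwardPath, Measure.deterministic_comp_eq_map]
    rfl
  | succ n ih =>
    refine Measure.ext_of_lintegral _ fun f hf => ?_
    have hs : Measurable fun p : (∀ i : Fin (n+1), E ↑i) × E (n+1) => f (Fin.snoc p.1 p.2) :=
      hf.comp (measurable_finSnoc n)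
    rw [Measure.lintegral_bind (Kernel.aemeasurable _) hf.aemeasurable, forwardPath,
      lintegral_map hf (measurable_finSnoc n), Measure.lintegral_compProd hs, ih,
      Measure.lintegral_bind (Kernel.aemeasurable _)
        (hs.lintegral_kernel_prod_right').aemeasurable]
    simp only [lintegral_backwardPath_succ K n _ hf]
    rw [← hrev n (fun p => ∫⁻ xs, f (Fin.snoc xs p.2) ∂(backwardPath K n p.1)) ?_]
    · refine lintegral_congr fun x => ?_
      simp only [Kernel.comap_apply]
      rw [lintegral_backwardPath_last K n x
        (f := fun p => ∫⁻ y, f (Fin.snoc p.1 y) ∂(Q n p.2)) ?_]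
      · exact lintegral_lintegral_swap (μ := backwardPath K n x) (ν := Q n x)
          (f := fun xs y => f (Fin.snoc xs y)) hs.aemeasurable
      · exact Measurable.lintegral_kernel_prod_right'
          (κ := (Q n).comap Prod.snd measurable_snd)
          (f := fun p : ((∀ i : Fin (n+1), E ↑i) × E n) × E (n+1) => f (Fin.snoc p.1.1 p.2))
          (hs.comp ((measurable_fst.comp measurable_fst).prodMk measurable_snd))
    · exact Measurable.lintegral_kernel_prod_right'
          (κ := (backwardPath K n).comap Prod.fst measurable_fst)
          (f := fun p : (E n × E (n+1)) × (∀ i : Fin (n+1), E ↑i) => f (Fin.snoc p.2 p.1.2))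
          (hs.comp (measurable_snd.prodMk (measurable_snd.comp measurable_fst)))

end PathMeasures

section BackwardKernel

lemma measurable_Qk (q : ℕ) (hG : Measurable (G q)) : Measurable (Qk M G q) :=
  Measure.measurable_of_measurable_coe _ fun s hs => by
    simp only [Qk, Measure.smul_apply, smul_eq_mul]
    exact hG.ennreal_ofReal.mul ((M q).measurable_coe hs)

/-- `Qk` as a kernel. -/
def QkKernel (hG : ∀ q, Measurable (G q)) (q : ℕ) : Kernel (E q) (E (q+1)) :=
  ⟨Qk M G q, measurable_Qk M G q (hG q)⟩

lemma isFiniteKernel_QkKernel (hGm : ∀ q, Measurable (G q)) (hG : ∀ q x, G q x ≤ 1)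
    (hM : ∀ q, IsMarkovKernel (M q)) (q : ℕ) : IsFiniteKernel (QkKernel M G hGm q) := by
  refine ⟨1, one_lt_top, fun x => ?_⟩
  have := hM q
  change (ENNReal.ofReal (G q x) • (M q x : Measure (E (q+1)))) Set.univ ≤ 1
  simpa using hG q x

lemma lintegral_nz {α : Type*} [MeasurableSpace α] (μ : Measure α) (f : α → ℝ≥0∞) :
    ∫⁻ x, f x ∂(nz μ) = (μ Set.univ)⁻¹ * ∫⁻ x, f x ∂μ := by
  rw [nz, lintegral_smul_measure, smul_eq_mul]

lemma isProbabilityMeasure_nz {α : Type*} [MeasurableSpace α] (μ : Measure α) [IsFiniteMeasure μ]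
    [NeZero μ] : IsProbabilityMeasure (nz μ) :=
  isProbabilityMeasureSMul

lemma isFiniteMeasure_gamma (η0 : Measure (E 0)) [IsFiniteMeasure η0]
    (hGm : ∀ q, Measurable (G q)) (hG : ∀ q x, G q x ≤ 1)
    (hM : ∀ q, IsMarkovKernel (M q)) (n : ℕ) : IsFiniteMeasure (gamma M G η0 n) := by
  induction n with
  | zero => assumption
  | succ n ih =>
    have := isFiniteKernel_QkKernel M G hGm hG hM n
    exact inferInstanceAs (IsFiniteMeasure ((gamma M G η0 n).bind (QkKernel M G hGm n)))

lemma neZero_gamma (η0 : Measure (E 0)) [NeZero η0]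
    (hGm : ∀ q, Measurable (G q)) (hG : ∀ q x, 0 < G q x)
    (hM : ∀ q, IsMarkovKernel (M q)) (n : ℕ) : NeZero (gamma M G η0 n) := by
  induction n with
  | zero => assumption
  | succ n ih =>
    refine ⟨fun h => ?_⟩
    have h0 : gamma M G η0 (n+1) Set.univ = 0 := by simp [h]
    rw [gamma, Measure.bind_apply .univ (measurable_Qk M G n (hGm n)).aemeasurable,
      lintegral_eq_zero_iff (f := fun x => Qk M G n x Set.univ)
        ((Measure.measurable_coe .univ).comp (measurable_Qk M G n (hGm n)))] at h0
    have hF : ∀ᵐ x ∂(gamma M G η0 n), False := by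
      filter_upwards [h0] with x hx
      have := hM n
      simp [Qk, (hG n x).not_ge] at hx
    exact ih.out (by simpa using hF)

lemma measurable_ofReal_mul (hGm : ∀ q, Measurable (G q))
    (hHm : ∀ q, Measurable (Function.uncurry (H q))) (q : ℕ) :
    Measurable fun p : E q × E (q+1) => ENNReal.ofReal (G q p.1 * H q p.1 p.2) :=
  (((hGm q).comp measurable_fst).mul (hHm q)).ennreal_ofReal

/-- `Mback` as a kernel. -/
def MbackKernel (hGm : ∀ q, Measurable (G q)) (hHm : ∀ q, Measurable (Function.uncurry (H q)))
    (q : ℕ) (η : Measure (E q)) [IsFiniteMeasure η] : Kernel (E (q+1)) (E q) where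
  toFun := Mback G H q η
  measurable' := by
    have hm := measurable_ofReal_mul G H hGm hHm q
    refine Measure.measurable_of_measurable_coe _ fun s hs => ?_
    simp only [Mback, Measure.smul_apply, smul_eq_mul, withDensity_apply _ hs]
    exact hm.lintegral_prod_left'.inv.mul hm.lintegral_prod_left'

lemma isMarkovKernel_MbackKernel (hGm : ∀ q, Measurable (G q))
    (hHm : ∀ q, Measurable (Function.uncurry (H q))) (q : ℕ) (η : Measure (E q)) [IsFiniteMeasure η]
    (h0 : ∀ y, ∫⁻ x, ENNReal.ofReal (G q x * H q x y) ∂η ≠ 0)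
    (htop : ∀ y, ∫⁻ x, ENNReal.ofReal (G q x * H q x y) ∂η ≠ ⊤) :
    IsMarkovKernel (MbackKernel G H hGm hHm q η) := by
  refine ⟨fun y => ⟨?_⟩⟩
  change Mback G H q η y Set.univ = 1
  simp [Mback, ENNReal.inv_mul_cancel (h0 y) (htop y)]

lemma lintegral_ofReal_mul_ne_zero (hGm : ∀ q, Measurable (G q)) (hG : ∀ q x, 0 < G q x)
    (hHm : ∀ q, Measurable (Function.uncurry (H q))) (hHpos : ∀ q x y, 0 < H q x y)
    (q : ℕ) (η : Measure (E q)) [NeZero η] (y : E (q+1)) :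
    ∫⁻ x, ENNReal.ofReal (G q x * H q x y) ∂η ≠ 0 := by
  have hm : Measurable fun x => ENNReal.ofReal (G q x * H q x y) :=
    (measurable_ofReal_mul G H hGm hHm q).comp measurable_prodMk_right
  intro h
  rw [lintegral_eq_zero_iff hm] at h
  have hF : ∀ᵐ x ∂η, False := by
    filter_upwards [h] with x hx
    simp [(mul_pos (hG q x) (hHpos q x y)).not_ge] at hx
  exact NeZero.ne η (by simpa using hF)

lemma lintegral_Qk (hG : ∀ q x, 0 < G q x)
    (hHm : ∀ q, Measurable (Function.uncurry (H q))) (q : ℕ) (ν : Measure (E (q+1)))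
    (hMH : ∀ x, (M q x : Measure (E (q+1))) = ν.withDensity fun y => ENNReal.ofReal (H q x y))
    (x : E q) {f : E (q+1) → ℝ≥0∞} (hf : Measurable f) :
    ∫⁻ y, f y ∂(Qk M G q x) = ∫⁻ y, ENNReal.ofReal (G q x * H q x y) * f y ∂ν := by
  have hH : Measurable fun y => ENNReal.ofReal (H q x y) :=
    ((hHm q).comp measurable_prodMk_left).ennreal_ofReal
  rw [Qk, lintegral_smul_measure, hMH, lintegral_withDensity_eq_lintegral_mul _ hH hf,
    smul_eq_mul, ← lintegral_const_mul _ (hH.mul hf)]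
  simp only [Pi.mul_apply, ENNReal.ofReal_mul (hG q x).le, mul_assoc]

/-- The backward kernel reverses `Qk` with respect to `μ`. -/
lemma lintegral_lintegral_Qk_eq_lintegral_lintegral_Mback
    (hGm : ∀ q, Measurable (G q)) (hG : ∀ q x, 0 < G q x)
    (hHm : ∀ q, Measurable (Function.uncurry (H q))) (q : ℕ)
    (ν : Measure (E (q+1))) [SFinite ν]
    (hMH : ∀ x, (M q x : Measure (E (q+1))) = ν.withDensity fun y => ENNReal.ofReal (H q x y))
    (μ : Measure (E q)) [IsFiniteMeasure μ] [NeZero μ]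
    (h0 : ∀ y, ∫⁻ x, ENNReal.ofReal (G q x * H q x y) ∂(nz μ) ≠ 0)
    (htop : ∀ y, ∫⁻ x, ENNReal.ofReal (G q x * H q x y) ∂(nz μ) ≠ ⊤)
    {g : E q × E (q+1) → ℝ≥0∞} (hg : Measurable g) :
    ∫⁻ x, ∫⁻ y, g (x, y) ∂(Qk M G q x) ∂μ
      = ∫⁻ y, ∫⁻ x, g (x, y) ∂(Mback G H q (nz μ) y) ∂(μ.bind (Qk M G q)) := by
  have := isProbabilityMeasure_nz μ
  have hm := measurable_ofReal_mul G H hGm hHm q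
  have := isMarkovKernel_MbackKernel G H hGm hHm q (nz μ) h0 htop
  have hgm : Measurable fun y => ∫⁻ x, g (x, y) ∂(Mback G H q (nz μ) y) :=
    (hg.comp measurable_swap).lintegral_kernel_prod_right' (κ := MbackKernel G H hGm hHm q (nz μ))
  have hc0 : μ Set.univ ≠ 0 := by simpa using NeZero.ne μ
  rw [Measure.lintegral_bind (measurable_Qk M G q (hGm q)).aemeasurable hgm.aemeasurable]
  simp only [lintegral_Qk M G H hG hHm q ν hMH _ hgm]
  have hl (x : E q) : ∫⁻ y, g (x, y) ∂(Qk M G q x)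
      = ∫⁻ y, ENNReal.ofReal (G q x * H q x y) * g (x, y) ∂ν :=
    lintegral_Qk M G H hG hHm q ν hMH x (hg.comp measurable_prodMk_left)
  simp only [hl]
  rw [lintegral_lintegral_swap (f := fun x y => ENNReal.ofReal (G q x * H q x y) * g (x, y))
      (hm.mul hg).aemeasurable,
    lintegral_lintegral_swap (f := fun x y => ENNReal.ofReal (G q x * H q x y) *
      ∫⁻ x', g (x', y) ∂(Mback G H q (nz μ) y)) (hm.mul (hgm.comp measurable_snd)).aemeasurable]
  refine lintegral_congr fun y => ?_
  have hmy : Measurable fun x => ENNReal.ofReal (G q x * H q x y) :=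
    hm.comp measurable_prodMk_right
  have hgy : Measurable fun x => g (x, y) := hg.comp measurable_prodMk_right
  rw [lintegral_mul_const _ hmy]
  have hA : ∫⁻ x, ENNReal.ofReal (G q x * H q x y) ∂μ
      = μ Set.univ * ∫⁻ x, ENNReal.ofReal (G q x * H q x y) ∂(nz μ) := by
    rw [lintegral_nz, ← mul_assoc, ENNReal.mul_inv_cancel hc0 (measure_ne_top _ _), one_mul]
  rw [hA, Mback, lintegral_smul_measure, smul_eq_mul, mul_assoc, ← mul_assoc (lintegral _ _) (_⁻¹),
    ENNReal.mul_inv_cancel (h0 y) (htop y), one_mul,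
    lintegral_withDensity_eq_lintegral_mul _ hmy hgy, lintegral_nz, ← mul_assoc,
    ENNReal.mul_inv_cancel hc0 (measure_ne_top _ _), one_mul]
  rfl

end BackwardKernel

/-- Lemma 4.1, second assertion. The normalized Feynman-Kac path measure
`ℚ_n = Γ_n / Γ_n(1)` admits the backward Markov chain representation
`ℚ_n(d(x_0,…,x_n)) = η_n(dx_n) ∏_{q=1}^n M_{q,η_{q-1}}(x_q,dx_{q-1})`, i.e. both probability
measures integrate every bounded measurable `F` equally. -/
theorem backward_markov_representation
    (lam : ∀ n, Measure (E n)) (η0 : Measure (E 0))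
    (hM : ∀ q, IsMarkovKernel (M q))
    (hGm : ∀ q, Measurable (G q)) (hG : ∀ q x, G q x ∈ Set.Ioc (0:ℝ) 1)
    (hHm : ∀ q, Measurable (Function.uncurry (H q)))
    (hHpos : ∀ q x y, 0 < H q x y)
    (hlam : ∀ n, SigmaFinite (lam n))
    (hMH : ∀ q x, (M q x : Measure (E (q+1)))
      = (lam (q+1)).withDensity fun y => ENNReal.ofReal (H q x y))
    (hHint : ∀ q (η : Measure (E q)), IsProbabilityMeasure η → ∀ y,
      ∫⁻ x, ENNReal.ofReal (G q x * H q x y) ∂η < ⊤)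
    (hη0 : IsProbabilityMeasure η0)
    (n : ℕ) (F : (∀ i : Fin (n+1), E ↑i) → ℝ) (hFm : Measurable F) (hFb : ∃ C, ∀ x, |F x| ≤ C) :
    GammaInt M G η0 n F
      = GammaInt M G η0 n (fun _ => (1:ℝ))
        * ∫ x, bwd0 G H (fun q => nz (gamma M G η0 q)) n x F ∂ (nz (gamma M G η0 n)) := by
  have hG0 : ∀ q x, 0 < G q x := fun q x => (hG q x).1
  have hG1 : ∀ q x, G q x ≤ 1 := fun q x => (hG q x).2
  have hγfin := isFiniteMeasure_gamma M G η0 hGm hG1 hM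
  have hγne := neZero_gamma M G η0 hGm hG0 hM
  have hnz := fun q => isProbabilityMeasure_nz (gamma M G η0 q)
  have h0 : ∀ q y, ∫⁻ x, ENNReal.ofReal (G q x * H q x y) ∂(nz (gamma M G η0 q)) ≠ 0 :=
    fun q y => lintegral_ofReal_mul_ne_zero G H hGm hG0 hHm hHpos q _ y
  have htop : ∀ q y, ∫⁻ x, ENNReal.ofReal (G q x * H q x y) ∂(nz (gamma M G η0 q)) ≠ ⊤ :=
    fun q y => (hHint q _ (hnz q) y).ne
  let Q := QkKernel M G hGm
  let K := fun q => MbackKernel G H hGm hHm q (nz (gamma M G η0 q))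
  have hQ : ∀ q, IsFiniteKernel (Q q) := isFiniteKernel_QkKernel M G hGm hG1 hM
  have hK : ∀ q, IsMarkovKernel (K q) :=
    fun q => isMarkovKernel_MbackKernel G H hGm hHm q _ (h0 q) (htop q)
  have hpath : forwardPath Q η0 n = (gamma M G η0 n).bind (backwardPath K n) :=
    forwardPath_eq_backwardPath_comp Q K (gamma M G η0)
      (fun q g hg => lintegral_lintegral_Qk_eq_lintegral_lintegral_Mback M G H
        hGm hG0 hHm q (lam (q+1)) (hMH q) _ (h0 q) (htop q) hg) n
  have hint : ∀ F : (∀ i : Fin (n+1), E ↑i) → ℝ, Measurable F → (∃ C, ∀ x, |F x| ≤ C) →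
      GammaInt M G η0 n F = ∫ x, ∫ xs, F xs ∂(backwardPath K n x) ∂(gamma M G η0 n) := by
    intro F hFm hFb
    rw [GammaInt_eq_integral_forwardPath M G Q (fun _ _ => rfl) η0 n F hFm hFb, hpath,
      Measure.comp_eq_comp_const_apply,
      Kernel.integral_comp (integrable_of_measurable_of_bounded hFm hFb), Kernel.const_apply]
  have hbwd (x : E n) : bwd0 G H (fun q => nz (gamma M G η0 q)) n x F
      = ∫ xs, F xs ∂(backwardPath K n x) :=
    bwd0_eq_integral_backwardPath G H K _ (fun _ _ => rfl) n x F hFm hFb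
  have hmass : (gamma M G η0 n).real Set.univ ≠ 0 := by
    simpa [measureReal_eq_zero_iff] using NeZero.ne (gamma M G η0 n)
  rw [hint F hFm hFb, hint _ measurable_const ⟨1, by simp⟩]
  simp only [hbwd]
  simp only [nz, integral_smul_measure, integral_const, probReal_univ, smul_eq_mul, mul_one,
    ENNReal.toReal_inv]
  rw [← mul_assoc]
  change _ = (gamma M G η0 n).real Set.univ * ((gamma M G η0 n).real Set.univ)⁻¹ * _
  rw [mul_inv_cancel₀ hmass, one_mul]

end
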